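/- Fix q ≥ 3, w > 0 and m ≥ 0. For n ≥ m, let X^n be the weighted-insertion coloring with parameters (q,w) on [-n,n]. As n → ∞, the restriction X^n|_{[-m,m]} converges in law to the weighted-insertion coloring on [-m,m] with parameters (q, w*), where w* = (q-1)/(q-2). -/

import Mathlib

open scoped Classical

/-- The probability mass function of the weighted-insertion coloring with `q`
colors `{0,…,q-1}` and weight `w` on `n` positions.  It is built iteratively:
a single position receives a uniform color; a coloring of length `n+1` arises
from a coloring of length `n` by inserting a new color at a random gap
(endpoint gaps weighted `w`, interior gaps weighted `1`), the inserted color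
chosen uniformly among the colors differing from both current neighbours of
the gap (`q-1` choices at an endpoint, `q-2` in the interior).  Summing over
the position of the last insertion yields the recursion used here. -/
noncomputable def wiC (q : ℕ) (w : ℝ) : ℕ → List ℕ → ℝ
  | 0, l => if l = [] then 1 else 0
  | 1, l => if l.length = 1 ∧ l.getD 0 0 < q then 1 / (q : ℝ) else 0
  | (n + 2), l =>
      if l.length = n + 2 ∧ l.Chain' (· ≠ ·) ∧ ∀ c ∈ l, c < q then
        ∑ i ∈ Finset.range (n + 2),
          ((if i = 0 ∨ i = n + 1 then w / ((q : ℝ) - 1) else 1 / ((q : ℝ) - 2)) /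
              (2 * w + (n : ℝ))) *
            wiC q w (n + 1) (l.eraseIdx i)
      else 0

/-- All sequences of `n` colors from `{0,…,q-1}`, as lists. -/
noncomputable def colorings (q n : ℕ) : Finset (List ℕ) :=
  Finset.image (fun f : Fin n → Fin q => List.ofFn fun i => (f i : ℕ)) Finset.univ
namespace WeightedInsertion

open Finset

/-- Proper colorings with colors in `{0,…,q-1}`. -/
def IsProper (q : ℕ) (l : List ℕ) : Prop := l.IsChain (· ≠ ·) ∧ ∀ c ∈ l, c < q

/-- The sum of `g` over all lists obtained from `l` by deleting one entry. -/
noncomputable def eraseSum (g : List ℕ → ℝ) (l : List ℕ) : ℝ :=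
  ∑ i ∈ range l.length, g (l.eraseIdx i)

/-- The marginal of `f` on a window with `a` positions to its left and `b` to its right. -/
noncomputable def marginal (q : ℕ) (f : List ℕ → ℝ) (a b : ℕ) (y : List ℕ) : ℝ :=
  ∑ u ∈ colorings q a, ∑ v ∈ colorings q b, f (u ++ y ++ v)

/-- The weighted-insertion weight of a list, its length being read off the list. -/
noncomputable def weight (q : ℕ) (w : ℝ) (l : List ℕ) : ℝ := wiC q w l.length l

/-! ### Sums over colorings -/

theorem mem_colorings {q n : ℕ} {l : List ℕ} :
    l ∈ colorings q n ↔ l.length = n ∧ ∀ c ∈ l, c < q := by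
  simp only [colorings, mem_image, mem_univ, true_and]
  constructor
  · rintro ⟨f, rfl⟩
    refine ⟨by simp, fun c hc => ?_⟩
    obtain ⟨i, rfl⟩ := List.mem_ofFn.1 hc
    exact (f i).2
  · rintro ⟨rfl, h⟩
    exact ⟨fun i => ⟨l.get i, h _ (List.get_mem _ _)⟩, by simp⟩

theorem colorings_zero (q : ℕ) : colorings q 0 = {[]} := by
  ext l
  simp only [mem_colorings, mem_singleton, List.length_eq_zero_iff]
  constructor
  · exact fun h => h.1
  · rintro rfl
    simp

theorem sum_colorings_succ (q n : ℕ) (f : List ℕ → ℝ) :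
    ∑ x ∈ colorings q (n + 1), f x = ∑ c ∈ range q, ∑ x ∈ colorings q n, f (c :: x) := by
  rw [← sum_product']
  symm
  refine sum_bij (fun p _ => p.1 :: p.2) ?_ ?_ ?_ ?_
  · rintro ⟨c, l⟩ h
    simp only [mem_product, Finset.mem_range, mem_colorings] at h ⊢
    simpa [h.2.1, h.1] using h.2.2
  · rintro ⟨c, l⟩ _ ⟨c', l'⟩ _ h
    simpa using h
  · intro l h
    rw [mem_colorings] at h
    cases l with
    | nil => simp at h
    | cons c l =>
      refine ⟨(c, l), ?_, rfl⟩
      simp only [mem_product, Finset.mem_range, mem_colorings]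
      simp only [List.length_cons, List.mem_cons, forall_eq_or_imp] at h
      exact ⟨h.2.1, by omega, h.2.2⟩
  · intros
    rfl

theorem sum_colorings_add (q m n : ℕ) (f : List ℕ → ℝ) :
    ∑ x ∈ colorings q (m + n), f x =
      ∑ u ∈ colorings q m, ∑ v ∈ colorings q n, f (u ++ v) := by
  induction m generalizing f with
  | zero => simp [colorings_zero]
  | succ m ih =>
    rw [Nat.add_right_comm, sum_colorings_succ, sum_colorings_succ]
    simp only [ih, List.cons_append]

/-! ### Marginals -/

theorem marginal_zero_zero (q : ℕ) (f : List ℕ → ℝ) : marginal q f 0 0 = f := by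
  ext y
  simp [marginal, colorings_zero]

theorem marginal_succ_left (q : ℕ) (f : List ℕ → ℝ) (a b : ℕ) (y : List ℕ) :
    marginal q f (a + 1) b y = ∑ c ∈ range q, marginal q f a b (c :: y) := by
  simp only [marginal]
  rw [sum_colorings_add q a 1, sum_comm (s := range q)]
  refine sum_congr rfl fun u _ => ?_
  simp [sum_colorings_succ q 0, colorings_zero]

theorem marginal_succ_right (q : ℕ) (f : List ℕ → ℝ) (a b : ℕ) (y : List ℕ) :
    marginal q f a (b + 1) y = ∑ c ∈ range q, marginal q f a b (y ++ [c]) := by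
  simp only [marginal]
  rw [sum_comm (s := range q)]
  refine sum_congr rfl fun u _ => ?_
  rw [sum_colorings_succ q b]
  simp

theorem sum_window_eq_marginal (q : ℕ) (f : List ℕ → ℝ) (a k b : ℕ) {y : List ℕ}
    (hy : y ∈ colorings q k) :
    ∑ x ∈ colorings q (a + (k + b)), (if (x.drop a).take k = y then f x else 0) =
      marginal q f a b y := by
  rw [sum_colorings_add, marginal]
  refine sum_congr rfl fun u hu => ?_
  rw [sum_colorings_add, sum_comm]
  refine sum_congr rfl fun v _ => ?_
  have hu' := (mem_colorings.1 hu).1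
  rw [sum_eq_single y]
  · have hk := (mem_colorings.1 hy).1
    subst hu' hk
    simp
  · intro z hz hzy
    have hk := (mem_colorings.1 hz).1
    subst hu' hk
    simp [hzy]
  · exact fun h => absurd hy h

section Nonneg

variable {q : ℕ} {f : List ℕ → ℝ}

theorem marginal_nonneg (hf : ∀ l, 0 ≤ f l) (a b : ℕ) (y : List ℕ) : 0 ≤ marginal q f a b y :=
  sum_nonneg fun _ _ => sum_nonneg fun _ _ => hf _

theorem marginal_eq_zero (hf : ∀ l, ¬ IsProper q l → f l = 0) (a b : ℕ) {y : List ℕ}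
    (hy : ¬ IsProper q y) : marginal q f a b y = 0 := by
  refine sum_eq_zero fun u _ => sum_eq_zero fun v _ => hf _ fun h => hy ?_
  refine ⟨h.1.infix ⟨u, v, rfl⟩, fun c hc => h.2 c (by simp [hc])⟩

theorem marginal_le_total (hf : ∀ l, 0 ≤ f l) (hf' : ∀ l, ¬ IsProper q l → f l = 0)
    (a b : ℕ) (y : List ℕ) : marginal q f a b y ≤ marginal q f (a + y.length) b [] := by
  induction y generalizing a with
  | nil => simp
  | cons c y ih =>
    by_cases hc : c < q
    · have h := single_le_sum (f := fun c => marginal q f a b (c :: y))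
        (fun c _ => marginal_nonneg hf a b (c :: y)) (Finset.mem_range.2 hc)
      rw [← marginal_succ_left] at h
      refine h.trans ((ih (a + 1)).trans_eq ?_)
      rw [List.length_cons, Nat.add_right_comm, Nat.add_assoc]
    · rw [marginal_eq_zero hf' a b fun h => hc (h.2 c (by simp))]
      exact marginal_nonneg hf _ _ _

end Nonneg

/-! ### Deletion sums -/

theorem eraseSum_cons (g : List ℕ → ℝ) (c : ℕ) (l : List ℕ) :
    eraseSum g (c :: l) = eraseSum (fun z => g (c :: z)) l + g l := by
  simp [eraseSum, sum_range_succ']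

theorem eraseSum_concat (g : List ℕ → ℝ) (l : List ℕ) (c : ℕ) :
    eraseSum g (l ++ [c]) = eraseSum (fun z => g (z ++ [c])) l + g l := by
  simp only [eraseSum, List.length_append, List.length_singleton, sum_range_succ]
  congr 1
  · refine sum_congr rfl fun i hi => ?_
    rw [List.eraseIdx_append_of_lt_length (Finset.mem_range.1 hi)]
  · simp [List.eraseIdx_append_of_length_le]

theorem sum_eraseSum (S : Finset ℕ) (g : ℕ → List ℕ → ℝ) (l : List ℕ) :
    ∑ c ∈ S, eraseSum (g c) l = eraseSum (fun z => ∑ c ∈ S, g c z) l :=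
  sum_comm

/-- Summing a deletion recursion over the color to the left of the window. -/
theorem deletion_recursion_cons {q : ℕ} {s T : ℝ} (hs : s * ((q : ℝ) - 2) = 1)
    {R R' A : List ℕ → ℝ} (hR' : ∀ l, R' l = ∑ c ∈ range q, R (c :: l))
    (hR : ∀ c l, R (c :: c :: l) = 0) {x : ℕ} (hx : x < q) (l : List ℕ)
    (h : ∀ c < q, c ≠ x →
      T * R (c :: x :: l) = A (c :: x :: l) + s * eraseSum R (c :: x :: l)) :
    T * R' (x :: l) = ∑ c ∈ (range q).erase x, A (c :: x :: l) + R (x :: l)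
      + s * eraseSum R' (x :: l) := by
  have hx' := Finset.mem_range.2 hx
  have h1 : ∀ z, ∑ c ∈ (range q).erase x, R (c :: x :: z) = R' (x :: z) := fun z => by
    rw [hR', ← add_sum_erase _ _ hx', hR, zero_add]
  have h2 : ∑ c ∈ (range q).erase x, R (c :: l) = R' l - R (x :: l) := by
    rw [hR', ← add_sum_erase _ _ hx', add_sub_cancel_left]
  have h3 : (((range q).erase x).card : ℝ) = q - 1 := by
    rw [card_erase_of_mem hx', card_range, Nat.cast_pred (by omega)]
  have h4 := sum_congr (rfl : (range q).erase x = _) fun c hc =>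
    h c (Finset.mem_range.1 (mem_of_mem_erase hc)) (ne_of_mem_erase hc)
  simp only [eraseSum_cons, sum_add_distrib, ← mul_sum, sum_eraseSum, h1, h2, sum_const,
    nsmul_eq_mul, h3] at h4
  rw [h4, eraseSum_cons]
  linear_combination R (x :: l) * hs

/-- Summing a deletion recursion over the color to the right of the window. -/
theorem deletion_recursion_concat {q : ℕ} {s T : ℝ} (hs : s * ((q : ℝ) - 2) = 1)
    {R R' A : List ℕ → ℝ} (hR' : ∀ l, R' l = ∑ c ∈ range q, R (l ++ [c]))
    (hR : ∀ c l, R (l ++ [c] ++ [c]) = 0) {x : ℕ} (hx : x < q) (l : List ℕ)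
    (h : ∀ c < q, c ≠ x →
      T * R (l ++ [x] ++ [c]) = A (l ++ [x] ++ [c]) + s * eraseSum R (l ++ [x] ++ [c])) :
    T * R' (l ++ [x]) = ∑ c ∈ (range q).erase x, A (l ++ [x] ++ [c]) + R (l ++ [x])
      + s * eraseSum R' (l ++ [x]) := by
  have hx' := Finset.mem_range.2 hx
  have h1 : ∀ z, ∑ c ∈ (range q).erase x, R (z ++ [x] ++ [c]) = R' (z ++ [x]) := fun z => by
    rw [hR', ← add_sum_erase _ _ hx', hR, zero_add]
  have h2 : ∑ c ∈ (range q).erase x, R (l ++ [c]) = R' l - R (l ++ [x]) := by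
    rw [hR', ← add_sum_erase _ _ hx', add_sub_cancel_left]
  have h3 : (((range q).erase x).card : ℝ) = q - 1 := by
    rw [card_erase_of_mem hx', card_range, Nat.cast_pred (by omega)]
  have h4 := sum_congr (rfl : (range q).erase x = _) fun c hc =>
    h c (Finset.mem_range.1 (mem_of_mem_erase hc)) (ne_of_mem_erase hc)
  simp only [eraseSum_concat, sum_add_distrib, ← mul_sum, sum_eraseSum, h1, h2, sum_const,
    nsmul_eq_mul, h3] at h4
  rw [h4, eraseSum_concat]
  linear_combination R (l ++ [x]) * hs

/-! ### The weighted-insertion weights -/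

section Weight

variable {q : ℕ} {w : ℝ}

theorem weight_nil : weight q w [] = 1 := by
  simp [weight, wiC]

theorem weight_singleton {c : ℕ} (hc : c < q) : weight q w [c] = 1 / (q : ℝ) := by
  simp [weight, wiC, hc]

theorem weight_eq_zero {l : List ℕ} (h : ¬ IsProper q l) : weight q w l = 0 := by
  match l with
  | [] => exact absurd ⟨List.isChain_nil, by simp⟩ h
  | [c] =>
    have : ¬ c < q := fun hc => h ⟨List.isChain_singleton c, by simpa using hc⟩
    simp [weight, wiC, this]
  | c :: d :: l =>
    simp only [weight, List.length_cons, wiC]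
    exact if_neg fun h' => h h'.2

theorem wiC_nonneg (hq : 3 ≤ q) (hw : 0 < w) (n : ℕ) (l : List ℕ) : 0 ≤ wiC q w n l := by
  have hq' : (3 : ℝ) ≤ q := by exact_mod_cast hq
  induction n generalizing l with
  | zero =>
    rw [wiC]
    split_ifs <;> simp
  | succ n ih =>
    cases n with
    | zero =>
      rw [wiC]
      split_ifs <;> positivity
    | succ n =>
      rw [wiC]
      split_ifs
      · refine sum_nonneg fun i _ => mul_nonneg (div_nonneg ?_ (by positivity)) (ih _)
        split_ifs
        · exact div_nonneg hw.le (by linarith)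
        · exact div_nonneg zero_le_one (by linarith)
      · rfl

theorem weight_nonneg (hq : 3 ≤ q) (hw : 0 < w) (l : List ℕ) : 0 ≤ weight q w l :=
  wiC_nonneg hq hw _ _

theorem weight_recursion (hw : 0 < w) {x z : ℕ} {l : List ℕ} (h : IsProper q (x :: (l ++ [z]))) :
    (2 * w + l.length) * weight q w (x :: (l ++ [z])) =
      (w / ((q : ℝ) - 1) - 1 / ((q : ℝ) - 2)) * (weight q w (l ++ [z]) + weight q w (x :: l))
        + 1 / ((q : ℝ) - 2) * eraseSum (weight q w) (x :: (l ++ [z])) := by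
  have hT : 2 * w + (l.length : ℝ) ≠ 0 := by positivity
  have hlen : (x :: (l ++ [z])).length = l.length + 2 := by simp
  have key : (2 * w + l.length) * weight q w (x :: (l ++ [z])) =
      ∑ i ∈ range (l.length + 2), (if i = 0 ∨ i = l.length + 1 then w / ((q : ℝ) - 1)
        else 1 / ((q : ℝ) - 2)) * weight q w ((x :: (l ++ [z])).eraseIdx i) := by
    rw [weight, hlen, wiC, if_pos ⟨hlen, h⟩, mul_sum]
    refine sum_congr rfl fun i hi => ?_
    have : ((x :: (l ++ [z])).eraseIdx i).length = l.length + 1 := by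
      rw [List.length_eraseIdx_of_lt (by rw [hlen]; exact Finset.mem_range.1 hi), hlen]
      rfl
    rw [weight, this]
    field_simp
  have hmid : ∀ i ∈ range l.length, (if i + 1 = 0 ∨ i + 1 = l.length + 1 then w / ((q : ℝ) - 1)
        else 1 / ((q : ℝ) - 2)) = 1 / ((q : ℝ) - 2) := fun i hi => by
    have := Finset.mem_range.1 hi
    rw [if_neg (by omega)]
  have hlast : (x :: (l ++ [z])).eraseIdx (l.length + 1) = x :: l := by
    simp [List.eraseIdx_append_of_length_le]
  rw [key, eraseSum, hlen, sum_range_succ, sum_range_succ', sum_range_succ, sum_range_succ',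
    sum_congr rfl fun i hi => by rw [hmid i hi], ← mul_sum, hlast]
  simp
  ring

theorem IsProper.cons {c x : ℕ} {l : List ℕ} (h : IsProper q (x :: l)) (hc : c < q)
    (hcx : c ≠ x) : IsProper q (c :: x :: l) :=
  ⟨List.isChain_cons_cons.2 ⟨hcx, h.1⟩, by
    intro d hd
    rcases List.mem_cons.1 hd with rfl | hd
    exacts [hc, h.2 d hd]⟩

theorem IsProper.concat {c x : ℕ} {l : List ℕ} (h : IsProper q (l ++ [x])) (hc : c < q)
    (hcx : c ≠ x) : IsProper q (l ++ [x] ++ [c]) :=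
  ⟨List.isChain_append.2 ⟨h.1, List.isChain_singleton c, by
      simpa using hcx.symm⟩, by
    intro d hd
    rcases List.mem_append.1 hd with hd | hd
    · exact h.2 d hd
    · simp only [List.mem_singleton] at hd
      exact hd ▸ hc⟩

theorem not_isProper_cons_cons (c : ℕ) (l : List ℕ) : ¬ IsProper q (c :: c :: l) :=
  fun h => (List.isChain_cons_cons.1 h.1).1 rfl

theorem not_isProper_concat_concat (c : ℕ) (l : List ℕ) : ¬ IsProper q (l ++ [c] ++ [c]) :=
  fun h => by simpa using (List.isChain_append.1 h.1).2.2

theorem marginal_weight_eq_zero (a b : ℕ) {y : List ℕ} (hy : ¬ IsProper q y) :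
    marginal q (weight q w) a b y = 0 :=
  marginal_eq_zero (fun _ h => weight_eq_zero h) a b hy

theorem sum_marginal_cons (a b : ℕ) {x : ℕ} (hx : x < q) (l : List ℕ) :
    ∑ c ∈ (range q).erase x, marginal q (weight q w) a b (c :: x :: l) =
      marginal q (weight q w) (a + 1) b (x :: l) := by
  rw [marginal_succ_left, ← add_sum_erase _ _ (Finset.mem_range.2 hx),
    marginal_weight_eq_zero _ _ (not_isProper_cons_cons x l), zero_add]

theorem sum_marginal_concat (a b : ℕ) {x : ℕ} (hx : x < q) (l : List ℕ) :
    ∑ c ∈ (range q).erase x, marginal q (weight q w) a b (l ++ [x] ++ [c]) =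
      marginal q (weight q w) a (b + 1) (l ++ [x]) := by
  rw [marginal_succ_right, ← add_sum_erase _ _ (Finset.mem_range.2 hx),
    marginal_weight_eq_zero _ _ (not_isProper_concat_concat x l), zero_add]

/-- The deletion recursion for a window touching the left endpoint only. -/
theorem marginal_zero_recursion (hq : 3 ≤ q) (hw : 0 < w) (b : ℕ) {x z : ℕ} {l : List ℕ}
    (h : IsProper q (x :: l ++ [z])) :
    (2 * w + b + l.length + 1) * marginal q (weight q w) 0 (b + 1) (x :: l ++ [z]) =
      (w / ((q : ℝ) - 1) - 1 / ((q : ℝ) - 2)) * marginal q (weight q w) 0 (b + 1) (l ++ [z])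
        + (b + w - 1 / ((q : ℝ) - 2)) * marginal q (weight q w) 0 b (x :: l ++ [z])
        + 1 / ((q : ℝ) - 2) * eraseSum (marginal q (weight q w) 0 (b + 1)) (x :: l ++ [z]) := by
  have hq' : (3 : ℝ) ≤ q := by exact_mod_cast hq
  have hq1 : (q : ℝ) - 1 ≠ 0 := by linarith
  have hq2 : (q : ℝ) - 2 ≠ 0 := by linarith
  have hs : 1 / ((q : ℝ) - 2) * ((q : ℝ) - 2) = 1 := by field_simp
  have hz : z < q := h.2 z (by simp)
  have hz' := Finset.mem_range.2 hz
  have hcard : (((range q).erase z).card : ℝ) = q - 1 := by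
    rw [card_erase_of_mem hz', card_range, Nat.cast_pred (by omega)]
  induction b generalizing x z l with
  | zero =>
    have := deletion_recursion_concat (q := q) (T := 2 * w + l.length + 1) hs
      (R := marginal q (weight q w) 0 0) (R' := marginal q (weight q w) 0 1)
      (A := fun y => (w / ((q : ℝ) - 1) - 1 / ((q : ℝ) - 2)) *
        (marginal q (weight q w) 0 0 y.tail + marginal q (weight q w) 0 0 y.dropLast))
      (marginal_succ_right q _ 0 0)
      (fun c l => marginal_weight_eq_zero 0 0 (not_isProper_concat_concat c l))
      hz (x :: l) (fun c hc hcz => by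
        have h' := h.concat hc hcz
        have := weight_recursion hw (x := x) (l := l ++ [z]) (z := c) (by simpa using h')
        simp only [marginal_zero_zero, List.dropLast_concat]
        simp only [List.cons_append, List.tail_cons] at this ⊢
        push_cast [List.length_append, List.length_singleton] at this
        linear_combination this)
    simp only [← mul_sum, sum_add_distrib, List.dropLast_concat, sum_const, nsmul_eq_mul,
      hcard] at this
    simp only [List.cons_append, List.tail_cons] at this
    rw [sum_marginal_concat 0 0 hz l] at this
    simp only [List.cons_append, Nat.cast_zero, zero_add] at this ⊢
    rw [show 2 * w + 0 + (l.length : ℝ) + 1 = 2 * w + l.length + 1 by ring, this]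
    field_simp
    ring
  | succ b ih =>
    have := deletion_recursion_concat (q := q) (T := 2 * w + (b + 1 : ℕ) + l.length + 1) hs
      (R := marginal q (weight q w) 0 (b + 1)) (R' := marginal q (weight q w) 0 (b + 1 + 1))
      (A := fun y => (w / ((q : ℝ) - 1) - 1 / ((q : ℝ) - 2)) *
        marginal q (weight q w) 0 (b + 1) y.tail
          + (b + w - 1 / ((q : ℝ) - 2)) * marginal q (weight q w) 0 b y)
      (marginal_succ_right q _ 0 (b + 1))
      (fun c l => marginal_weight_eq_zero 0 (b + 1) (not_isProper_concat_concat c l))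
      hz (x :: l) (fun c hc hcz => by
        have hc' := Finset.mem_range.2 hc
        have := ih (x := x) (l := l ++ [z]) (z := c) (by simpa using h.concat hc hcz) hc hc' (by
          rw [card_erase_of_mem hc', card_range, Nat.cast_pred (by omega)])
        simp only [List.cons_append, List.tail_cons] at this ⊢
        push_cast [List.length_append, List.length_singleton] at this ⊢
        linear_combination this)
    simp only [← mul_sum, sum_add_distrib] at this
    rw [sum_marginal_concat 0 b hz (x :: l)] at this
    simp only [List.cons_append, List.tail_cons] at this
    rw [sum_marginal_concat 0 (b + 1) hz l] at this
    simp only [List.cons_append]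
    rw [this]
    push_cast
    ring

/-- The deletion recursion for a window touching neither endpoint. -/
theorem marginal_recursion (hq : 3 ≤ q) (hw : 0 < w) (a b : ℕ) {y : List ℕ} (hy : y ≠ [])
    (h : IsProper q y) :
    (2 * w + a + b + y.length) * marginal q (weight q w) (a + 1) (b + 1) y =
      (a + w - 1 / ((q : ℝ) - 2)) * marginal q (weight q w) a (b + 1) y
        + (b + w - 1 / ((q : ℝ) - 2)) * marginal q (weight q w) (a + 1) b y
        + 1 / ((q : ℝ) - 2) * eraseSum (marginal q (weight q w) (a + 1) (b + 1)) y := by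
  have hq' : (3 : ℝ) ≤ q := by exact_mod_cast hq
  have hq1 : (q : ℝ) - 1 ≠ 0 := by linarith
  have hq2 : (q : ℝ) - 2 ≠ 0 := by linarith
  have hs : 1 / ((q : ℝ) - 2) * ((q : ℝ) - 2) = 1 := by field_simp
  induction a generalizing y with
  | zero =>
    obtain ⟨x, l, rfl⟩ := List.exists_cons_of_ne_nil hy
    have hx : x < q := h.2 x (by simp)
    have hcard : (((range q).erase x).card : ℝ) = q - 1 := by
      rw [card_erase_of_mem (Finset.mem_range.2 hx), card_range, Nat.cast_pred (by omega)]
    have := deletion_recursion_cons (q := q) (T := 2 * w + b + (x :: l).length) hs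
      (R := marginal q (weight q w) 0 (b + 1)) (R' := marginal q (weight q w) 1 (b + 1))
      (A := fun y => (w / ((q : ℝ) - 1) - 1 / ((q : ℝ) - 2)) *
        marginal q (weight q w) 0 (b + 1) y.tail
          + (b + w - 1 / ((q : ℝ) - 2)) * marginal q (weight q w) 0 b y)
      (marginal_succ_left q _ 0 (b + 1))
      (fun c l => marginal_weight_eq_zero 0 (b + 1) (not_isProper_cons_cons c l))
      hx l (fun c hc hcx => by
        have hp := h.cons hc hcx
        obtain ⟨l', z, hl⟩ : ∃ l' z, x :: l = l' ++ [z] :=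
          ⟨_, _, (List.dropLast_append_getLast hy).symm⟩
        rw [hl] at hp ⊢
        have := marginal_zero_recursion hq hw b (x := c) (l := l') (z := z) hp
        simp only [List.cons_append, List.tail_cons] at this ⊢
        push_cast [List.length_append, List.length_singleton] at this ⊢
        linear_combination this)
    simp only [← mul_sum, sum_add_distrib, sum_const, nsmul_eq_mul, hcard, List.tail_cons] at this
    rw [sum_marginal_cons 0 b hx l] at this
    simp only [Nat.cast_zero, zero_add, add_zero] at this ⊢
    rw [this]
    field_simp
    ring
  | succ a ih =>
    obtain ⟨x, l, rfl⟩ := List.exists_cons_of_ne_nil hy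
    have hx : x < q := h.2 x (by simp)
    have := deletion_recursion_cons (q := q) (T := 2 * w + (a + 1 : ℕ) + b + (x :: l).length) hs
      (R := marginal q (weight q w) (a + 1) (b + 1))
      (R' := marginal q (weight q w) (a + 1 + 1) (b + 1))
      (A := fun y => (a + w - 1 / ((q : ℝ) - 2)) * marginal q (weight q w) a (b + 1) y
        + (b + w - 1 / ((q : ℝ) - 2)) * marginal q (weight q w) (a + 1) b y)
      (marginal_succ_left q _ (a + 1) (b + 1))
      (fun c l => marginal_weight_eq_zero (a + 1) (b + 1) (not_isProper_cons_cons c l))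
      hx l (fun c hc hcx => by
        have := ih (y := c :: x :: l) (by simp) (h.cons hc hcx)
        rw [List.length_cons] at this
        push_cast at this ⊢
        linear_combination this)
    simp only [← mul_sum, sum_add_distrib] at this
    rw [sum_marginal_cons a (b + 1) hx l, sum_marginal_cons (a + 1) b hx l] at this
    rw [this]
    push_cast
    ring

theorem marginal_nil_shift (f : List ℕ → ℝ) (a b : ℕ) :
    marginal q f a b [] = marginal q f (a + b) 0 [] := by
  induction b generalizing a with
  | zero => rfl
  | succ b ih =>
    have : marginal q f a (b + 1) [] = marginal q f (a + 1) b [] := by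
      rw [marginal_succ_left, marginal_succ_right]
      rfl
    rw [this, ih, Nat.add_right_comm, Nat.add_assoc]

theorem isProper_singleton {c : ℕ} (hc : c < q) : IsProper q [c] :=
  ⟨List.isChain_singleton c, by simpa using hc⟩

theorem sum_weight_two (hq : 3 ≤ q) (hw : 0 < w) : marginal q (weight q w) 2 0 [] = 1 := by
  have hq' : (3 : ℝ) ≤ q := by exact_mod_cast hq
  have hq0 : (q : ℝ) ≠ 0 := by linarith
  have hq1 : (q : ℝ) - 1 ≠ 0 := by linarith
  have key : ∀ x ∈ range q, marginal q (weight q w) 1 0 [x] = 1 / (q : ℝ) := fun x hx => by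
    have hx' := Finset.mem_range.1 hx
    rw [← sum_marginal_cons 0 0 hx' [], marginal_zero_zero]
    have hc : ∀ c ∈ (range q).erase x, weight q w [c, x] = 1 / (q * ((q : ℝ) - 1)) := fun c hc => by
      have hc' := Finset.mem_range.1 (mem_of_mem_erase hc)
      have := weight_recursion (q := q) hw (x := c) (l := []) (z := x)
        ((isProper_singleton hx').cons hc' (ne_of_mem_erase hc))
      simp only [List.nil_append, eraseSum_cons, List.length_nil, weight_singleton hx',
        weight_singleton hc'] at this
      simp only [eraseSum, List.length_nil, range_zero, sum_empty] at this
      apply mul_left_cancel₀ (show 2 * w + ((0 : ℕ) : ℝ) ≠ 0 by simp [hw.ne'])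
      rw [this]
      have hq2 : (q : ℝ) - 2 ≠ 0 := by linarith
      simp only [Nat.cast_zero, add_zero]
      field_simp
      ring
    rw [sum_congr rfl hc, sum_const, card_erase_of_mem hx, card_range, nsmul_eq_mul,
      Nat.cast_pred (by omega)]
    field_simp
  rw [marginal_succ_left, sum_congr rfl key]
  simp [hq0]

theorem sum_weight (hq : 3 ≤ q) (hw : 0 < w) (n : ℕ) : marginal q (weight q w) n 0 [] = 1 := by
  have hq' : (3 : ℝ) ≤ q := by exact_mod_cast hq
  have hq2 : (q : ℝ) - 2 ≠ 0 := by linarith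
  match n with
  | 0 => rw [marginal_zero_zero, weight_nil]
  | 1 =>
    rw [marginal_succ_left, marginal_zero_zero,
      sum_congr rfl fun c hc => weight_singleton (Finset.mem_range.1 hc)]
    have : (q : ℝ) ≠ 0 := by linarith
    simp [this]
  | 2 => exact sum_weight_two hq hw
  | n + 3 =>
    have ih := sum_weight hq hw (n + 2)
    have h := sum_congr (rfl : range q = _) fun c hc =>
      marginal_recursion hq hw n 0 (y := [c]) (by simp) (isProper_singleton (Finset.mem_range.1 hc))
    have h0 : ∀ (g : List ℕ → ℝ) c, eraseSum g [c] = g [] := fun g c => by simp [eraseSum]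
    simp only [List.length_singleton, h0, sum_add_distrib, ← mul_sum, ← marginal_succ_left,
      sum_const, nsmul_eq_mul, card_range] at h
    rw [marginal_nil_shift _ (n + 1 + 1) (0 + 1), marginal_nil_shift _ (n + 1) (0 + 1)] at h
    simp only [zero_add, add_assoc, Nat.reduceAdd, ih] at h
    have hT : 2 * w + n + 1 ≠ 0 := by positivity
    apply mul_left_cancel₀ hT
    simp only [Nat.cast_zero, Nat.cast_one, mul_one, zero_add] at h
    rw [show 2 * w + (n : ℝ) + 1 = 2 * w + (n + 1) by ring, h]
    field_simp
    ring

theorem marginal_nil (hq : 3 ≤ q) (hw : 0 < w) (a b : ℕ) :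
    marginal q (weight q w) a b [] = 1 := by
  rw [marginal_nil_shift, sum_weight hq hw]

theorem marginal_le_one (hq : 3 ≤ q) (hw : 0 < w) (a b : ℕ) (y : List ℕ) :
    marginal q (weight q w) a b y ≤ 1 :=
  (marginal_le_total (weight_nonneg hq hw) (fun _ h => weight_eq_zero h) a b y).trans_eq
    (marginal_nil hq hw _ _)

/-- At the critical weight all deletions carry the same coefficient. -/
theorem weight_critical_recursion (hq : 3 ≤ q) {y : List ℕ} (hy : y ≠ []) (h : IsProper q y) :
    (y.length + 2 * (1 / ((q : ℝ) - 2))) * weight q (((q : ℝ) - 1) / ((q : ℝ) - 2)) y =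
      1 / ((q : ℝ) - 2) * eraseSum (weight q (((q : ℝ) - 1) / ((q : ℝ) - 2))) y := by
  have hq' : (3 : ℝ) ≤ q := by exact_mod_cast hq
  have hq0 : (q : ℝ) ≠ 0 := by linarith
  have hq1 : (q : ℝ) - 1 ≠ 0 := by linarith
  have hq2 : (q : ℝ) - 2 ≠ 0 := by linarith
  obtain ⟨x, l, rfl⟩ := List.exists_cons_of_ne_nil hy
  rcases List.eq_nil_or_concat' l with rfl | ⟨l, z, rfl⟩
  · rw [weight_singleton (h.2 x (by simp)), eraseSum_cons, weight_nil]
    simp only [eraseSum, List.length_nil, range_zero, sum_empty, List.length_singleton]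
    push_cast
    field_simp
    ring
  · have hw : 0 < ((q : ℝ) - 1) / ((q : ℝ) - 2) := div_pos (by linarith) (by linarith)
    have := weight_recursion hw h
    rw [div_right_comm, div_self hq1, sub_self, zero_mul, zero_add] at this
    rw [← this]
    push_cast [List.length_cons, List.length_append, List.length_nil]
    field_simp
    ring

end Weight

/-! ### Convergence -/

/-- A barrier argument: an array obeying the deletion recursion with small forcing decays away
from the endpoints. -/
theorem decay_of_recursion {k w s C : ℝ} (hk : 1 ≤ k) (hw : 0 < w) (hs : 0 < s) (hs1 : s ≤ 1)
    (hC : 0 ≤ C) {E : ℕ → ℕ → ℝ} (hE : ∀ a b, |E a b| ≤ 1)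
    (hrec : ∀ a b : ℕ, |(2 * w + a + b + k) * E (a + 1) (b + 1) -
      ((a + w - s) * E a (b + 1) + (b + w - s) * E (a + 1) b)| ≤
        s * (k * (C * (1 / ((a : ℝ) + 2) + 1 / ((b : ℝ) + 2))))) (a b : ℕ) :
    |E a b| ≤ (k + w + s) * (1 + k * C) *
      (1 / ((a : ℝ) + (k + w - 1 + s)) + 1 / ((b : ℝ) + (k + w - 1 + s))) := by
  obtain ⟨c, hc⟩ : ∃ c, c = k + w - 1 + s := ⟨_, rfl⟩
  obtain ⟨D, hD⟩ : ∃ D, D = (k + w + s) * (1 + k * C) := ⟨_, rfl⟩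
  rw [← hc, ← hD]
  have hc0 : 0 < c := by linarith
  have hkC : 0 ≤ k * C := by positivity
  have hD0 : 1 + c ≤ D := by rw [hD, hc]; nlinarith
  have hpos : ∀ n : ℕ, 0 ≤ 1 / ((n : ℝ) + c) := fun n => by positivity
  have hsmall : ∀ n : ℕ, n ≤ 1 → 1 ≤ D * (1 / ((n : ℝ) + c)) := fun n hn => by
    have : (n : ℝ) ≤ 1 := by exact_mod_cast hn
    rw [mul_one_div, le_div_iff₀ (by positivity)]
    linarith
  have hone : ∀ a b : ℕ, a ≤ 1 ∨ b ≤ 1 → 1 ≤ D * (1 / ((a : ℝ) + c) + 1 / ((b : ℝ) + c)) := by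
    intro a b hab
    have ha := mul_nonneg (by linarith : 0 ≤ D) (hpos a)
    have hb := mul_nonneg (by linarith : 0 ≤ D) (hpos b)
    rw [mul_add]
    rcases hab with h | h
    · linarith [hsmall a h]
    · linarith [hsmall b h]
  have hslack : ∀ n : ℕ, (n + w - s) * (D * (1 / ((n : ℝ) + c))) +
      s * (k * (C * (1 / ((n : ℝ) + 2)))) ≤ (n + k + w + s) * (D * (1 / (((n + 1 : ℕ) : ℝ) + c))) := fun n => by
    have hn : (0 : ℝ) ≤ n := n.cast_nonneg
    have h1 : (n + k + w + s) * (D * (1 / (((n + 1 : ℕ) : ℝ) + c))) = D := by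
      have : ((n + 1 : ℕ) : ℝ) + c = n + k + w + s := by rw [hc]; push_cast; ring
      rw [this]
      field_simp
    have h2 : (n + w - s) * (D * (1 / ((n : ℝ) + c))) = D - D * (k + 2 * s - 1) / (n + c) := by
      rw [hc] at hc0 ⊢
      field_simp
      ring
    have h3 : s * (k * (C * (1 / ((n : ℝ) + 2)))) ≤ D * (k + 2 * s - 1) / (n + c) := by
      rw [show s * (k * (C * (1 / ((n : ℝ) + 2)))) = s * (k * C) / (n + 2) by ring,
        div_le_div_iff₀ (by positivity) (by positivity)]
      have h4 : (n : ℝ) + c ≤ (1 + c) * (n + 2) := by nlinarith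
      have h5 : (1 + c) * (k * C) ≤ D := by rw [hD, hc]; nlinarith
      calc s * (k * C) * (n + c) ≤ s * (k * C) * ((1 + c) * (n + 2)) := by gcongr
        _ = s * ((1 + c) * (k * C)) * (n + 2) := by ring
        _ ≤ s * D * (n + 2) := by gcongr
        _ ≤ D * (k + 2 * s - 1) * (n + 2) := by
          gcongr ?_ * _
          nlinarith
    rw [h1, h2]
    linarith
  induction a generalizing b with
  | zero => exact (hE _ _).trans (hone _ _ (by omega))
  | succ a iha =>
    induction b with
    | zero => exact (hE _ _).trans (hone _ _ (by omega))
    | succ b ihb =>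
      by_cases hab : a = 0 ∨ b = 0
      · exact (hE _ _).trans (hone _ _ (by omega))
      have ha : 1 ≤ a := by omega
      have hb : 1 ≤ b := by omega
      have ha' : (1 : ℝ) ≤ a := by exact_mod_cast ha
      have hb' : (1 : ℝ) ≤ b := by exact_mod_cast hb
      have hT : 0 < 2 * w + a + b + k := by positivity
      have hα : 0 ≤ a + w - s := by linarith
      have hβ : 0 ≤ b + w - s := by linarith
      have h1 := mul_le_mul_of_nonneg_left (iha (b + 1)) hα
      have h2 := mul_le_mul_of_nonneg_left ihb hβ
      have h3 := hrec a b
      have h4 := hslack a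
      have h5 := hslack b
      have h6 : (2 * w + a + b + k) * |E (a + 1) (b + 1)| ≤
          s * (k * (C * (1 / ((a : ℝ) + 2) + 1 / ((b : ℝ) + 2)))) +
            ((a + w - s) * |E a (b + 1)| + (b + w - s) * |E (a + 1) b|) := by
        have e1 : (2 * w + a + b + k) * |E (a + 1) (b + 1)| =
            |(2 * w + a + b + k) * E (a + 1) (b + 1)| := by rw [abs_mul, abs_of_pos hT]
        have e2 := abs_add_le ((a + w - s) * E a (b + 1)) ((b + w - s) * E (a + 1) b)
        rw [abs_mul, abs_mul, abs_of_nonneg hα, abs_of_nonneg hβ] at e2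
        have e3 := abs_sub_abs_le_abs_sub ((2 * w + a + b + k) * E (a + 1) (b + 1))
          ((a + w - s) * E a (b + 1) + (b + w - s) * E (a + 1) b)
        linarith
      refine le_of_mul_le_mul_left ?_ hT
      linarith

theorem abs_marginal_sub_weight_le {q : ℕ} {w : ℝ} (hq : 3 ≤ q) (hw : 0 < w) (k : ℕ) :
    ∃ C : ℝ, 0 ≤ C ∧ ∀ y : List ℕ, y.length = k → ∀ a b : ℕ,
      |marginal q (weight q w) a b y - weight q (((q : ℝ) - 1) / ((q : ℝ) - 2)) y| ≤
        C * (1 / ((a : ℝ) + 1) + 1 / ((b : ℝ) + 1)) := by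
  have hq' : (3 : ℝ) ≤ q := by exact_mod_cast hq
  obtain ⟨s, hs⟩ : ∃ s, s = 1 / ((q : ℝ) - 2) := ⟨_, rfl⟩
  have hs0 : 0 < s := hs ▸ one_div_pos.2 (by linarith)
  have hs1 : s ≤ 1 := by
    rw [hs, div_le_one (by linarith)]
    linarith
  obtain ⟨v, hv⟩ : ∃ v, v = ((q : ℝ) - 1) / ((q : ℝ) - 2) := ⟨_, rfl⟩
  have hv0 : 0 < v := hv ▸ div_pos (by linarith) (by linarith)
  rw [← hv]
  induction k with
  | zero =>
    refine ⟨0, le_rfl, fun y hy a b => ?_⟩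
    rw [List.length_eq_zero_iff.1 hy, marginal_nil hq hw, weight_nil]
    simp
  | succ k ih =>
    obtain ⟨C, hC, hE⟩ := ih
    obtain ⟨K, hK⟩ : ∃ K : ℝ, K = (k + 1 : ℕ) := ⟨_, rfl⟩
    have hK1 : 1 ≤ K := by rw [hK]; push_cast; linarith [(k.cast_nonneg : (0 : ℝ) ≤ k)]
    obtain ⟨c, hc⟩ : ∃ c, c = K + w - 1 + s := ⟨_, rfl⟩
    have hc0 : 0 < c := by linarith
    refine ⟨(K + w + s) * (1 + K * C) * (1 + 1 / c), by positivity, fun y hy a b => ?_⟩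
    by_cases hp : IsProper q y
    · have hy0 : y ≠ [] := by rintro rfl; simp at hy
      have hbound := decay_of_recursion (E := fun a b => marginal q (weight q w) a b y - weight q v y)
        hK1 hw hs0 hs1 hC (fun a b => abs_le.2 ⟨?_, ?_⟩) (fun a b => ?_) a b
      · refine hbound.trans ?_
        rw [← hc, mul_assoc ((K + w + s) * (1 + K * C))]
        gcongr
        have key : ∀ n : ℕ, 1 / ((n : ℝ) + c) ≤ (1 + 1 / c) * (1 / ((n : ℝ) + 1)) := fun n => by
          have hn : (0 : ℝ) ≤ n := n.cast_nonneg
          rw [mul_one_div, div_le_div_iff₀ (by positivity) (by positivity)]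
          have : (1 + 1 / c) * (n + c) = n + 1 + (n / c + c) := by field_simp; ring
          rw [this]
          have : 0 ≤ n / c + c := by positivity
          linarith
        linarith [key a, key b]
      · have := marginal_nonneg (q := q) (weight_nonneg hq hw) a b y
        have := marginal_le_one hq hv0 0 0 y
        rw [marginal_zero_zero] at this
        linarith
      · have := marginal_le_one hq hw a b y
        have := weight_nonneg hq hv0 y
        linarith
      · have h1 := marginal_recursion hq hw a b hy0 hp
        have h2 := weight_critical_recursion hq hy0 hp
        rw [← hs, hy, ← hK] at h1
        rw [← hv, ← hs, hy, ← hK] at h2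
        have h3 : (2 * w + a + b + K) *
              (marginal q (weight q w) (a + 1) (b + 1) y - weight q v y) -
            ((a + w - s) * (marginal q (weight q w) a (b + 1) y - weight q v y) +
              (b + w - s) * (marginal q (weight q w) (a + 1) b y - weight q v y)) =
            s * ∑ i ∈ range y.length,
              (marginal q (weight q w) (a + 1) (b + 1) (y.eraseIdx i)
                - weight q v (y.eraseIdx i)) := by
          rw [sum_sub_distrib]
          simp only [eraseSum] at h1 h2
          linear_combination h1 - h2
        rw [h3, abs_mul, abs_of_pos hs0]
        gcongr
        refine (abs_sum_le_sum_abs _ _).trans ?_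
        have h4 := sum_le_card_nsmul (range y.length) (fun i =>
          |marginal q (weight q w) (a + 1) (b + 1) (y.eraseIdx i) - weight q v (y.eraseIdx i)|)
          (C * (1 / ((a : ℝ) + 2) + 1 / ((b : ℝ) + 2))) fun i hi => by
            have := hE (y.eraseIdx i) (by
              rw [List.length_eraseIdx_of_lt (Finset.mem_range.1 hi), hy]; rfl) (a + 1) (b + 1)
            push_cast [add_assoc] at this
            norm_num at this ⊢
            exact this
        rwa [card_range, nsmul_eq_mul, hy, ← hK, ← hy] at h4
    · rw [marginal_weight_eq_zero _ _ hp, weight_eq_zero hp]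
      simp only [sub_self, abs_zero]
      positivity

end WeightedInsertion

open WeightedInsertion
/-- as `n → ∞`, the restriction to `[-m,m]` of the
weighted-insertion coloring with parameters `(q,w)` on `[-n,n]` (encoded on
positions `0,…,2n`, position `i+n` standing for `i`) converges in law (in
total variation) to the weighted-insertion coloring on `[-m,m]` with
parameters `(q, w*)`, where `w* = (q-1)/(q-2)`. -/
theorem wiC_restriction_converges (q : ℕ) (hq : 3 ≤ q) (w : ℝ) (hw : 0 < w) (m : ℕ) :
    Filter.Tendsto
      (fun n : ℕ => ∑ y ∈ colorings q (2 * m + 1),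
        |(∑ x ∈ colorings q (2 * n + 1),
            if (x.drop (n - m)).take (2 * m + 1) = y then wiC q w (2 * n + 1) x else 0)
          - wiC q (((q : ℝ) - 1) / ((q : ℝ) - 2)) (2 * m + 1) y|)
      Filter.atTop (nhds 0) := by
  rw [show nhds (0 : ℝ) = nhds (∑ _y ∈ colorings q (2 * m + 1), 0) by simp]
  refine tendsto_finsetSum _ fun y hy => ?_
  obtain ⟨C, -, hC⟩ := abs_marginal_sub_weight_le hq hw (2 * m + 1)
  have hlen := (mem_colorings.1 hy).1
  have hlim : Filter.Tendsto (fun n : ℕ => C * (1 / (((n - m : ℕ) : ℝ) + 1) +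
      1 / (((n - m : ℕ) : ℝ) + 1))) Filter.atTop (nhds 0) := by
    have h := (tendsto_one_div_add_atTop_nhds_zero_nat (𝕜 := ℝ)).comp
      (Filter.tendsto_sub_atTop_nat m)
    simpa using (h.add h).const_mul C
  refine squeeze_zero' (Filter.Eventually.of_forall fun n => abs_nonneg _) ?_ hlim
  filter_upwards [Filter.eventually_ge_atTop m] with n hn
  refine le_of_eq_of_le ?_ (hC y hlen (n - m) (n - m))
  congr 2
  · rw [← sum_window_eq_marginal q (weight q w) (n - m) (2 * m + 1) (n - m) hy,
      show n - m + (2 * m + 1 + (n - m)) = 2 * n + 1 by omega]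
    refine Finset.sum_congr rfl fun x hx => ?_
    rw [weight, (mem_colorings.1 hx).1]
  · rw [weight, hlen]
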